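/- Let A : [0,∞) → Mₙ(ℝ) be a differentiable solution of A′(t) = 2[[A(t)⁺,A(t)⁻],A(t)] − ‖A(t)⁺‖²·A(t) (the reduced Anomaly flow with slope parameter α' = 0, so f ≡ 1). Then for every t ≥ 0, ‖A(t)⁺‖² ≤ ‖A(0)⁺‖² / (1 + ½‖A(0)⁺‖²·t). In particular A(t)⁺ → 0 as t → ∞. -/

import Mathlib

noncomputable section

open Matrix

attribute [local instance] Matrix.normedAddCommGroup Matrix.normedSpace

/-- The symmetric part `X⁺ = (X + Xᵀ)/2` of a square matrix. -/
def symPart {n : ℕ} (X : Matrix (Fin n) (Fin n) ℝ) : Matrix (Fin n) (Fin n) ℝ :=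
  (1/2 : ℝ) • (X + Xᵀ)

/-- The skew-symmetric part `X⁻ = (X − Xᵀ)/2` of a square matrix. -/
def skewPart {n : ℕ} (X : Matrix (Fin n) (Fin n) ℝ) : Matrix (Fin n) (Fin n) ℝ :=
  (1/2 : ℝ) • (X - Xᵀ)

/-- The matrix commutator `[X, Y] = XY − YX`. -/
def mcomm {n : ℕ} (X Y : Matrix (Fin n) (Fin n) ℝ) : Matrix (Fin n) (Fin n) ℝ :=
  X * Y - Y * X

/-- The squared Frobenius norm `‖X‖² = ⟨X, X⟩ = tr(XXᵀ)`. -/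
def nsq {n : ℕ} (X : Matrix (Fin n) (Fin n) ℝ) : ℝ := Matrix.trace (X * Xᵀ)

/-- `f(X) = 1 − c‖X⁺‖²`, where `c` corresponds to `(α'/4)·(τ(τ−1)²/8)`. -/
def fval (c : ℝ) {n : ℕ} (X : Matrix (Fin n) (Fin n) ℝ) : ℝ := 1 - c * nsq (symPart X)

/-- The right-hand side of the reduced Anomaly flow ODE:
`f(X)·(2[[X⁺,X⁻],X] − ‖X⁺‖²·X)`. -/
def rhs (c : ℝ) {n : ℕ} (X : Matrix (Fin n) (Fin n) ℝ) : Matrix (Fin n) (Fin n) ℝ :=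
  fval c X • ((2 : ℝ) • mcomm (mcomm (symPart X) (skewPart X)) X - nsq (symPart X) • X)

theorem nsq_eq_sum {n : ℕ} (X : Matrix (Fin n) (Fin n) ℝ) : nsq X = ∑ i, ∑ j, X i j ^ 2 := by
  simp [nsq, Matrix.trace, Matrix.mul_apply, sq]

theorem nsq_nonneg' {n : ℕ} (X : Matrix (Fin n) (Fin n) ℝ) : 0 ≤ nsq X := by
  rw [nsq_eq_sum]; positivity

theorem entry_le {n : ℕ} (X : Matrix (Fin n) (Fin n) ℝ) (i j : Fin n) : X i j ^ 2 ≤ nsq X := by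
  rw [nsq_eq_sum]
  calc X i j ^ 2 ≤ ∑ j, X i j ^ 2 :=
        Finset.single_le_sum (f := fun j => X i j ^ 2) (fun _ _ => sq_nonneg _) (Finset.mem_univ j)
    _ ≤ _ := Finset.single_le_sum (f := fun i => ∑ j, X i j ^ 2)
        (fun _ _ => Finset.sum_nonneg fun _ _ => sq_nonneg _) (Finset.mem_univ i)

theorem nsq_deriv {n : ℕ} (A : ℝ → Matrix (Fin n) (Fin n) ℝ) (R : Matrix (Fin n) (Fin n) ℝ)
    (s : Set ℝ) (t : ℝ) (h : HasDerivWithinAt A R s t) :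
    HasDerivWithinAt (fun t => nsq (symPart (A t)))
      (2 * Matrix.trace (symPart (A t) * (symPart R)ᵀ)) s t := by
  have he : ∀ i j, HasDerivWithinAt (fun t => A t i j) (R i j) s t := fun i j =>
    hasDerivWithinAt_pi.1 (hasDerivWithinAt_pi.1 h i) j
  have hs : ∀ i j, HasDerivWithinAt (fun t => symPart (A t) i j) (symPart R i j) s t := by
    intro i j
    simpa [symPart] using ((he i j).add (he j i)).const_mul (1/2 : ℝ)
  have : HasDerivWithinAt (fun t => ∑ i, ∑ j, symPart (A t) i j ^ 2)
      (∑ i, ∑ j, 2 * (symPart (A t) i j * symPart R i j)) s t := by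
    refine HasDerivWithinAt.fun_sum fun i _ => HasDerivWithinAt.fun_sum fun j _ => ?_
    refine ((hs i j).fun_pow 2).congr_deriv ?_
    norm_num; ring
  simp only [nsq_eq_sum]
  convert this using 1
  simp [Matrix.trace, Matrix.mul_apply, Finset.mul_sum]

theorem symPart_rhs {n : ℕ} (X : Matrix (Fin n) (Fin n) ℝ) :
    symPart (rhs 0 X) = (2 : ℝ) • mcomm (mcomm (symPart X) (skewPart X)) (skewPart X)
      - nsq (symPart X) • symPart X := by
  have hS : (symPart X)ᵀ = symPart X := by simp [symPart, add_comm]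
  have hK : (skewPart X)ᵀ = - skewPart X := by
    simp [skewPart, ← smul_neg]
  have hX : X = symPart X + skewPart X := by
    ext i j; simp [symPart, skewPart]; ring
  generalize hc : nsq (symPart X) = c
  have : rhs 0 X = (2 : ℝ) • mcomm (mcomm (symPart X) (skewPart X)) (symPart X + skewPart X)
      - c • (symPart X + skewPart X) := by
    rw [← hX, ← hc]; simp [rhs, fval]
  rw [this]
  generalize symPart X = S at *
  generalize skewPart X = K at *
  simp only [symPart, mcomm, transpose_sub, transpose_smul, transpose_mul, transpose_add, hS, hK]
  simp only [mul_add, add_mul, mul_sub, sub_mul, neg_mul, mul_neg, neg_neg, Matrix.mul_assoc]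
  module

theorem trace_ineq {n : ℕ} (X : Matrix (Fin n) (Fin n) ℝ) :
    2 * Matrix.trace (symPart X * (symPart (rhs 0 X))ᵀ) ≤ - (1/2) * nsq (symPart X) ^ 2 := by
  have hS : (symPart X)ᵀ = symPart X := by simp [symPart, add_comm]
  have hK : (skewPart X)ᵀ = - skewPart X := by
    simp [skewPart, ← smul_neg]
  rw [symPart_rhs]
  have hB := nsq_nonneg' (mcomm (symPart X) (skewPart X))
  generalize hc : nsq (symPart X) = c
  have hc' : Matrix.trace (symPart X * symPart X) = c := by rw [← hc, nsq, hS]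
  clear hc
  generalize symPart X = S at *
  generalize skewPart X = K at *
  have hBt : (mcomm S K)ᵀ = mcomm S K := by
    simp only [mcomm, transpose_sub, transpose_mul, hS, hK]; simp; abel
  rw [nsq, hBt] at hB
  have key : Matrix.trace (S * (mcomm (mcomm S K) K)ᵀ) = - Matrix.trace (mcomm S K * mcomm S K) := by
    have e : Matrix.trace (mcomm S K * mcomm S K)
        = Matrix.trace (mcomm S K * (S * K)) - Matrix.trace (mcomm S K * (K * S)) := by
      rw [← trace_sub, ← mul_sub]; rfl
    rw [e]
    generalize mcomm S K = B at hBt hB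
    simp only [mcomm, transpose_sub, transpose_mul, hBt, hK, mul_sub, trace_sub, neg_mul, mul_neg,
      trace_neg]
    rw [Matrix.trace_mul_comm B (S * K), ← Matrix.mul_assoc B K S, Matrix.trace_mul_comm (B * K) S,
      Matrix.mul_assoc S K B]
    ring
  simp only [transpose_sub, transpose_smul, hS, mul_sub, trace_sub, Matrix.mul_smul, trace_smul, key, hc',
    smul_eq_mul]
  nlinarith [sq_nonneg c]

theorem decay (y y' : ℝ → ℝ) (h0 : ∀ t, 0 ≤ y t)
    (hd : ∀ t ∈ Set.Ici (0 : ℝ), HasDerivWithinAt y (y' t) (Set.Ici 0) t)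
    (hy : ∀ t, y' t ≤ -(1/2) * y t ^ 2) (t : ℝ) (ht : 0 ≤ t) :
    y t ≤ y 0 / (1 + 1/2 * y 0 * t) := by
  have hanti : AntitoneOn y (Set.Ici 0) := by
    refine antitoneOn_of_hasDerivWithinAt_nonpos (f' := y') (convex_Ici 0)
      (fun x hx => (hd x hx).continuousWithinAt)
      (fun x hx => (hd x (interior_subset hx)).mono interior_subset) fun x _ => ?_
    nlinarith [hy x, sq_nonneg (y x)]
  have hden : 0 < 1 + 1/2 * y 0 * t := by have := h0 0; positivity
  rcases (h0 t).eq_or_lt with h | hpos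
  · rw [← h]; exact div_nonneg (h0 0) hden.le
  have hp : ∀ s ∈ Set.Icc 0 t, 0 < y s := fun s hs =>
    hpos.trans_le (hanti (Set.mem_Ici.2 hs.1) (Set.mem_Ici.2 ht) hs.2)
  have hg : ∀ s ∈ Set.Icc 0 t, HasDerivWithinAt (fun s => (y s)⁻¹ - 1/2 * s)
      (-y' s / y s ^ 2 - 1/2 * 1) (Set.Icc 0 t) s := fun s hs =>
    (((hd s hs.1).mono Set.Icc_subset_Ici_self).fun_inv (hp s hs).ne').sub
      ((hasDerivWithinAt_id s _).const_mul _)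
  have hmono : MonotoneOn (fun s => (y s)⁻¹ - 1/2 * s) (Set.Icc 0 t) := by
    refine monotoneOn_of_hasDerivWithinAt_nonneg (convex_Icc 0 t)
      (fun x hx => (hg x hx).continuousWithinAt)
      (fun x hx => (hg x (interior_subset hx)).mono interior_subset) fun x hx => ?_
    have := hp x (interior_subset hx)
    have h2 : 1/2 ≤ -y' x / y x ^ 2 := by
      rw [le_div_iff₀ (by positivity)]; linarith [hy x]
    linarith
  have h1 := hmono (Set.left_mem_Icc.2 ht) (Set.right_mem_Icc.2 ht) ht
  have hp0 := hp 0 (Set.left_mem_Icc.2 ht)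
  simp only at h1
  rw [le_div_iff₀ hden]
  have h3 : (y 0)⁻¹ + 1/2 * t ≤ (y t)⁻¹ := by linarith
  have h4 := mul_le_mul_of_nonneg_left h3 (mul_pos hp0 hpos).le
  have e1 : y 0 * y t * ((y 0)⁻¹ + 1/2 * t) = y t * (1 + 1/2 * y 0 * t) := by field_simp
  have e2 : y 0 * y t * (y t)⁻¹ = y 0 := by field_simp
  linarith

/-- Let `A : [0,∞) → Mₙ(ℝ)` be a differentiable solution of
`A′ = 2[[A⁺,A⁻],A] − ‖A⁺‖²A` (the reduced Anomaly flow with slope parameter `α' = 0`,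
i.e. `c = 0`, `f ≡ 1`). Then for every `t ≥ 0`,
`‖A(t)⁺‖² ≤ ‖A(0)⁺‖² / (1 + ½‖A(0)⁺‖²·t)`, and in particular `A(t)⁺ → 0` as `t → ∞`. -/
theorem stmt17 (n : ℕ) (A : ℝ → Matrix (Fin n) (Fin n) ℝ)
    (hA : ∀ t ∈ Set.Ici (0 : ℝ), HasDerivWithinAt A (rhs 0 (A t)) (Set.Ici 0) t) :
    (∀ t ∈ Set.Ici (0 : ℝ),
        nsq (symPart (A t)) ≤ nsq (symPart (A 0)) / (1 + 1/2 * nsq (symPart (A 0)) * t)) ∧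
    Filter.Tendsto (fun t => symPart (A t)) Filter.atTop (nhds 0) := by
  have h1 : ∀ t ∈ Set.Ici (0 : ℝ),
      nsq (symPart (A t)) ≤ nsq (symPart (A 0)) / (1 + 1/2 * nsq (symPart (A 0)) * t) :=
    fun t ht => decay (fun t => nsq (symPart (A t))) _ (fun t => nsq_nonneg' _)
      (fun t ht => nsq_deriv A _ _ t (hA t ht)) (fun t => trace_ineq (A t)) t ht
  refine ⟨h1, ?_⟩
  have hlim : Filter.Tendsto (fun t => nsq (symPart (A t))) Filter.atTop (nhds 0) := by
    rcases (nsq_nonneg' (symPart (A 0))).eq_or_lt with h | h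
    · refine tendsto_const_nhds.congr' ?_
      filter_upwards [Filter.eventually_ge_atTop 0] with t ht
      have := h1 t ht
      rw [← h] at this
      simp only [zero_div] at this
      exact le_antisymm (nsq_nonneg' _) this
    · refine squeeze_zero' (Filter.Eventually.of_forall fun t => nsq_nonneg' _)
        (Filter.eventually_atTop.2 ⟨0, h1⟩) ?_
      refine Filter.Tendsto.const_div_atTop ?_ _
      exact Filter.tendsto_atTop_add_const_left _ _
        (Filter.tendsto_id.const_mul_atTop (by positivity))
  refine tendsto_pi_nhds.2 fun i => tendsto_pi_nhds.2 fun j => ?_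
  have hsq : Filter.Tendsto (fun t => symPart (A t) i j ^ 2) Filter.atTop (nhds 0) :=
    squeeze_zero (fun t => sq_nonneg _) (fun t => entry_le _ i j) hlim
  have h3 := hsq.sqrt
  simp only [Real.sqrt_sq_eq_abs, Real.sqrt_zero] at h3
  exact (tendsto_zero_iff_abs_tendsto_zero _).2 h3
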